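/- Let X̃_1 be the first generation space with τ_n = n and F(n,i) = 2^i. Then the non-centered maximal operator M is of weak type (1,1) with constant 2: λ μ({x : Mf(x) > λ}) ≤ 2 ‖f‖_1 for all f ∈ ℓ^1 and all λ > 0. -/

import Mathlib

open scoped ENNReal Classical
open Filter Set

/-- The point set of a first generation space: roots `x_n` (`Sum.inl n`) and
leaves `x_{n,i}` (`Sum.inr ⟨n, i⟩`, `i` among `τ n` leaves of branch `n`). -/
abbrev XPt (τ : ℕ → ℕ) := ℕ ⊕ (Σ n : ℕ, Fin (τ n))

namespace FirstGen

/-- The root `x_n`. -/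
def root (τ : ℕ → ℕ) (n : ℕ) : XPt τ := Sum.inl n

/-- The leaf `x_{n,i}`. -/
def leaf (τ : ℕ → ℕ) (n : ℕ) (i : Fin (τ n)) : XPt τ := Sum.inr ⟨n, i⟩

/-- The branch `S_n = {x_n, x_{n,1}, …, x_{n,τ_n}}`. -/
def branch (τ : ℕ → ℕ) (n : ℕ) : Set (XPt τ) :=
  {x | x = root τ n ∨ ∃ i, x = leaf τ n i}

/-- The two-point set `{x_n, x_{n,i}}`. -/
def pairB (τ : ℕ → ℕ) (n : ℕ) (i : Fin (τ n)) : Set (XPt τ) :=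
  {root τ n, leaf τ n i}

/-- The collection of all open balls of `X_τ`: singletons, pairs `{x_n, x_{n,i}}`,
branches `S_n` and the whole space. -/
def balls (τ : ℕ → ℕ) : Set (Set (XPt τ)) :=
  {B | (∃ x, B = {x}) ∨ (∃ n i, B = pairB τ n i) ∨ (∃ n, B = branch τ n) ∨ B = Set.univ}

/-- The ball `B(x, 3/2)` centered at `x`. -/
def cball (τ : ℕ → ℕ) : XPt τ → Set (XPt τ)
  | Sum.inl n => branch τ n
  | Sum.inr ⟨n, i⟩ => pairB τ n i

/-- The weight (measure of the singleton): `μ({x_n}) = d n`,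
`μ({x_{n,i}}) = d n * F n i`. -/
noncomputable def weight (τ : ℕ → ℕ) (d : ℕ → ℝ≥0∞)
    (F : (n : ℕ) → Fin (τ n) → ℝ≥0∞) : XPt τ → ℝ≥0∞
  | Sum.inl n => d n
  | Sum.inr ⟨n, i⟩ => d n * F n i

/-- Measure of a set. -/
noncomputable def mass {τ : ℕ → ℕ} (w : XPt τ → ℝ≥0∞) (s : Set (XPt τ)) : ℝ≥0∞ :=
  ∑' x : s, w x.1

/-- Average `A_s(f)` of `f` over `s`. -/
noncomputable def avg {τ : ℕ → ℕ} (w f : XPt τ → ℝ≥0∞) (s : Set (XPt τ)) : ℝ≥0∞ :=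
  (∑' x : s, f x.1 * w x.1) / mass w s

/-- The centered Hardy–Littlewood maximal operator of `X_τ` (the three balls
centered at `x` are `{x}`, `cball τ x` and the whole space). -/
noncomputable def Mc {τ : ℕ → ℕ} (w f : XPt τ → ℝ≥0∞) (x : XPt τ) : ℝ≥0∞ :=
  avg w f {x} ⊔ avg w f (cball τ x) ⊔ avg w f Set.univ

/-- The non-centered Hardy–Littlewood maximal operator of `X_τ`. -/
noncomputable def Mnc {τ : ℕ → ℕ} (w f : XPt τ → ℝ≥0∞) (x : XPt τ) : ℝ≥0∞ :=
  ⨆ (B : Set (XPt τ)) (_ : B ∈ balls τ) (_ : x ∈ B), avg w f B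

/-- `‖f‖_p^p = ∑_x f(x)^p μ({x})`. -/
noncomputable def lpp {τ : ℕ → ℕ} (w : XPt τ → ℝ≥0∞) (p : ℝ) (f : XPt τ → ℝ≥0∞) : ℝ≥0∞ :=
  ∑' x, f x ^ p * w x

/-- `T` is of strong type `(p,p)` (stated on the level of `p`-th powers). -/
def strongT {τ : ℕ → ℕ} (w : XPt τ → ℝ≥0∞)
    (T : (XPt τ → ℝ≥0∞) → XPt τ → ℝ≥0∞) (p : ℝ) : Prop :=
  ∃ C : ℝ≥0∞, C ≠ ∞ ∧ ∀ f, lpp w p (T f) ≤ C * lpp w p f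

/-- `T` is of weak type `(p,p)` (stated on the level of `p`-th powers). -/
def weakT {τ : ℕ → ℕ} (w : XPt τ → ℝ≥0∞)
    (T : (XPt τ → ℝ≥0∞) → XPt τ → ℝ≥0∞) (p : ℝ) : Prop :=
  ∃ C : ℝ≥0∞, C ≠ ∞ ∧ ∀ f (l : ℝ≥0∞), l ^ p * mass w {x | l < T f x} ≤ C * lpp w p f

/-- `‖g‖_{p,∞}^p`. -/
noncomputable def wnormP {τ : ℕ → ℕ} (w : XPt τ → ℝ≥0∞) (p : ℝ) (g : XPt τ → ℝ≥0∞) : ℝ≥0∞ :=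
  ⨆ l : ℝ≥0∞, l ^ p * mass w {x | l < g x}

/-- The Dirac function `δ_{x_n}`. -/
noncomputable def dirac (τ : ℕ → ℕ) (n : ℕ) : XPt τ → ℝ≥0∞ :=
  fun x => if x = root τ n then 1 else 0

end FirstGen

open FirstGen

/-- The weights `c * 2 ^ (i + 1)` grow geometrically, so the root of weight `c` together with the
leaves up to index `j` weighs at most twice the pair formed by the root and the `j`-th leaf. -/
theorem add_sum_geometric_le (c : ℝ≥0∞) (j : ℕ) :
    c + ∑ i ∈ Finset.range (j + 1), c * 2 ^ (i + 1) ≤ 2 * (c + c * 2 ^ (j + 1)) := by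
  have key : 2 * c + ∑ i ∈ Finset.range (j + 1), c * 2 ^ (i + 1) = 2 * (c * 2 ^ (j + 1)) := by
    induction j with
    | zero => simp; ring
    | succ j ih => rw [Finset.sum_range_succ, ← add_assoc, ih]; ring
  calc c + ∑ i ∈ Finset.range (j + 1), c * 2 ^ (i + 1)
      ≤ 2 * c + ∑ i ∈ Finset.range (j + 1), c * 2 ^ (i + 1) := by
        gcongr
        exact le_mul_of_one_le_left' one_le_two
    _ ≤ 2 * (c + c * 2 ^ (j + 1)) := by
        rw [key]
        gcongr
        exact le_add_self

/-- Weak-type bound on one branch covered by pairs and singletons: `u`, `v i` are the weights of the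
parts of the root and the leaves lying in the level set, and `a`, `b i` are the corresponding
integrals. -/
theorem mul_add_sum_le_of_pair_cover {N : ℕ} {l c a u : ℝ≥0∞} {b v : Fin N → ℝ≥0∞}
    (huc : u ≤ c) (hvc : ∀ i, v i ≤ c * 2 ^ ((i : ℕ) + 1))
    (hu : u = 0 ∨ l * c ≤ a ∨ ∃ i : Fin N, l * (c + c * 2 ^ ((i : ℕ) + 1)) ≤ a + b i)
    (hv : ∀ i, v i = 0 ∨ l * (c * 2 ^ ((i : ℕ) + 1)) ≤ b i ∨
      l * (c + c * 2 ^ ((i : ℕ) + 1)) ≤ a + b i) :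
    l * (u + ∑ i, v i) ≤ 2 * (a + ∑ i, b i) := by
  have single : ∀ i : Fin N, ¬ l * (c + c * 2 ^ ((i : ℕ) + 1)) ≤ a + b i → l * v i ≤ b i := by
    intro i hi
    rcases hv i with h | h | h
    · simp [h]
    · exact (mul_le_mul_right (hvc i) l).trans h
    · exact absurd h hi
  rcases (Finset.univ.filter fun i : Fin N =>
    l * (c + c * 2 ^ ((i : ℕ) + 1)) ≤ a + b i).eq_empty_or_nonempty with hP | hP
  · have hno : ∀ i : Fin N, ¬ l * (c + c * 2 ^ ((i : ℕ) + 1)) ≤ a + b i := by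
      simpa [Finset.filter_eq_empty_iff] using hP
    have hu' : l * u ≤ a := by
      rcases hu with h | h | ⟨i, h⟩
      · simp [h]
      · exact (mul_le_mul_right huc l).trans h
      · exact absurd h (hno i)
    rw [mul_add, Finset.mul_sum]
    exact (add_le_add hu' (Finset.sum_le_sum fun i _ => single i (hno i))).trans
      (le_mul_of_one_le_left' one_le_two)
  · obtain ⟨j, hj, hmax⟩ := Finset.exists_max_image _ (fun i : Fin N => (i : ℕ)) hP
    have hj : l * (c + c * 2 ^ ((j : ℕ) + 1)) ≤ a + b j := by simpa using hj
    have hlast : ∀ i : Fin N, ¬ (i : ℕ) ≤ j → l * v i ≤ b i := fun i hi =>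
      single i fun h => hi (hmax i (by simpa using h))
    have hsplit : ∀ i, v i ≤ (if (i : ℕ) ≤ j then c * 2 ^ ((i : ℕ) + 1) else 0) +
        (if (i : ℕ) ≤ j then 0 else v i) := by
      intro i
      split_ifs
      · simpa using hvc i
      · simp
    have hlow : ∑ i : Fin N, (if (i : ℕ) ≤ j then c * 2 ^ ((i : ℕ) + 1) else 0) ≤
        ∑ i ∈ Finset.range ((j : ℕ) + 1), c * 2 ^ (i + 1) := by
      rw [Fin.sum_univ_eq_sum_range (fun i => if i ≤ (j : ℕ) then c * 2 ^ (i + 1) else 0) N,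
        ← Finset.sum_filter]
      refine Finset.sum_le_sum_of_subset fun i hi => ?_
      simp only [Finset.mem_filter, Finset.mem_range] at hi ⊢
      omega
    have hhigh : b j + ∑ i : Fin N, l * (if (i : ℕ) ≤ j then 0 else v i) ≤ ∑ i, b i := by
      rw [← Finset.add_sum_erase _ _ (Finset.mem_univ j),
        ← Finset.add_sum_erase _ b (Finset.mem_univ j)]
      simp only [le_refl, if_true, mul_zero, zero_add]
      gcongr with i
      split_ifs with h
      · simp
      · exact hlast i h
    calc l * (u + ∑ i, v i)
        ≤ l * (c + (∑ i ∈ Finset.range ((j : ℕ) + 1), c * 2 ^ (i + 1) +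
            ∑ i : Fin N, (if (i : ℕ) ≤ j then 0 else v i))) := by
          gcongr
          refine (Finset.sum_le_sum fun i _ => hsplit i).trans ?_
          rw [Finset.sum_add_distrib]
          gcongr
      _ ≤ l * (2 * (c + c * 2 ^ ((j : ℕ) + 1)) +
            ∑ i : Fin N, (if (i : ℕ) ≤ j then 0 else v i)) := by
          rw [← add_assoc]
          gcongr
          exact add_sum_geometric_le c j
      _ = 2 * (l * (c + c * 2 ^ ((j : ℕ) + 1))) +
            ∑ i : Fin N, l * (if (i : ℕ) ≤ j then 0 else v i) := by
          rw [mul_add, Finset.mul_sum]; ring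
      _ ≤ 2 * (a + b j) + 2 * ∑ i : Fin N, l * (if (i : ℕ) ≤ j then 0 else v i) := by
          gcongr
          exact le_mul_of_one_le_left' one_le_two
      _ = 2 * (a + (b j + ∑ i : Fin N, l * (if (i : ℕ) ≤ j then 0 else v i))) := by ring
      _ ≤ 2 * (a + ∑ i, b i) := by gcongr

namespace FirstGen

variable {τ : ℕ → ℕ}

theorem tsum_branch (g : XPt τ → ℝ≥0∞) (n : ℕ) :
    ∑' x : branch τ n, g x.1 = g (root τ n) + ∑ i, g (leaf τ n i) := by
  have hB : branch τ n =
      ((insert (root τ n) (Finset.univ.image (leaf τ n)) : Finset (XPt τ)) : Set (XPt τ)) := by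
    ext x
    simp [branch, eq_comm]
  rw [hB, Finset.tsum_subtype' _ g, Finset.sum_insert (by simp [root, leaf]),
    Finset.sum_image (by intro i _ j _ h; simpa [leaf] using h)]

theorem tsum_pairB (g : XPt τ → ℝ≥0∞) (n : ℕ) (i : Fin (τ n)) :
    ∑' x : pairB τ n i, g x.1 = g (root τ n) + g (leaf τ n i) := by
  have hB : pairB τ n i = (({root τ n, leaf τ n i} : Finset (XPt τ)) : Set (XPt τ)) := by
    simp [pairB]
  rw [hB, Finset.tsum_subtype' _ g, Finset.sum_pair (by simp [root, leaf])]

theorem tsum_eq_tsum_branches (g : XPt τ → ℝ≥0∞) :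
    ∑' x, g x = ∑' n, (g (root τ n) + ∑ i, g (leaf τ n i)) := by
  rw [ENNReal.summable.tsum_sum ENNReal.summable, ENNReal.tsum_sigma', ENNReal.tsum_add]
  simp only [tsum_fintype]
  rfl

theorem mul_mass_le_of_lt_avg {w f : XPt τ → ℝ≥0∞} {s : Set (XPt τ)} {l : ℝ≥0∞}
    (h : l < avg w f s) : l * mass w s ≤ ∑' x : s, f x.1 * w x.1 :=
  ENNReal.mul_le_of_le_div h.le

theorem exists_ball_of_lt_Mnc {w f : XPt τ → ℝ≥0∞} {x : XPt τ} {l : ℝ≥0∞}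
    (h : l < Mnc w f x) : ∃ B ∈ balls τ, x ∈ B ∧ l * mass w B ≤ ∑' y : B, f y.1 * w y.1 := by
  simp only [Mnc, lt_iSup_iff] at h
  obtain ⟨B, hB, hx, h⟩ := h
  exact ⟨B, hB, hx, mul_mass_le_of_lt_avg h⟩

/-- Outside the case of the whole space, each branch meets the level set of the non-centered
maximal operator in measure at most `2 / l` times the integral over that branch. -/
theorem mul_branch_le {d : ℕ → ℝ≥0∞} {F : (n : ℕ) → Fin (τ n) → ℝ≥0∞}
    (hF : ∀ n i, F n i = 2 ^ ((i : ℕ) + 1)) {f : XPt τ → ℝ≥0∞} {l : ℝ≥0∞}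
    (huniv : ¬ l * mass (weight τ d F) univ ≤
      ∑' x : (univ : Set (XPt τ)), f x.1 * weight τ d F x.1) (n : ℕ) :
    l * ({x | l < Mnc (weight τ d F) f x}.indicator (weight τ d F) (root τ n) +
        ∑ i, {x | l < Mnc (weight τ d F) f x}.indicator (weight τ d F) (leaf τ n i)) ≤
      2 * (f (root τ n) * weight τ d F (root τ n) +
        ∑ i, f (leaf τ n i) * weight τ d F (leaf τ n i)) := by
  set w := weight τ d F
  set E := {x | l < Mnc w f x}
  have hind : ∀ x, E.indicator w x ≤ w x := fun x => indicator_le_self' (fun _ _ => zero_le) x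
  have hroot : w (root τ n) = d n := rfl
  have hleaf : ∀ i, w (leaf τ n i) = d n * 2 ^ ((i : ℕ) + 1) := fun i => by
    rw [← hF n i]; rfl
  by_cases hS : l * mass w (branch τ n) ≤ ∑' y : branch τ n, f y.1 * w y.1
  · rw [mass, tsum_branch, tsum_branch (fun x => f x * w x)] at hS
    calc _ ≤ l * (w (root τ n) + ∑ i, w (leaf τ n i)) := by
          gcongr <;> exact hind _
      _ ≤ _ := hS.trans (le_mul_of_one_le_left' one_le_two)
  · have hpair : ∀ i, l * mass w (pairB τ n i) ≤ ∑' y : pairB τ n i, f y.1 * w y.1 →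
        l * (d n + d n * 2 ^ ((i : ℕ) + 1)) ≤
          f (root τ n) * w (root τ n) + f (leaf τ n i) * w (leaf τ n i) := by
      intro i h
      rw [← hleaf, ← hroot]
      rwa [mass, tsum_pairB, tsum_pairB (fun x => f x * w x)] at h
    have hsingle : ∀ x : XPt τ, l * mass w {x} ≤ ∑' y : ({x} : Set (XPt τ)), f y.1 * w y.1 →
        l * w x ≤ f x * w x := by
      intro x h
      rwa [mass, tsum_singleton x w, tsum_singleton x (fun x => f x * w x)] at h
    refine mul_add_sum_le_of_pair_cover ((hind _).trans_eq hroot)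
      (fun i => (hind _).trans_eq (hleaf i)) ?_ fun i => ?_
    · by_cases hx : root τ n ∈ E
      · refine Or.inr ?_
        obtain ⟨B, hB, hxB, h⟩ := exists_ball_of_lt_Mnc hx
        rcases hB with ⟨x, rfl⟩ | ⟨m, i, rfl⟩ | ⟨m, rfl⟩ | rfl
        · obtain rfl : root τ n = x := hxB
          exact Or.inl (hsingle _ h)
        · obtain rfl : n = m := by simpa [pairB, root, leaf] using hxB
          exact Or.inr ⟨i, hpair i h⟩
        · obtain rfl : n = m := by simpa [branch, root, leaf] using hxB
          exact absurd h hS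
        · exact absurd h huniv
      · exact Or.inl (indicator_of_notMem hx _)
    · by_cases hx : leaf τ n i ∈ E
      · refine Or.inr ?_
        obtain ⟨B, hB, hxB, h⟩ := exists_ball_of_lt_Mnc hx
        rcases hB with ⟨x, rfl⟩ | ⟨m, k, rfl⟩ | ⟨m, rfl⟩ | rfl
        · obtain rfl : leaf τ n i = x := hxB
          rw [← hleaf]
          exact Or.inl (hsingle _ h)
        · have hxB : n = m ∧ HEq i k := by simpa [pairB, root, leaf] using hxB
          obtain ⟨rfl, hik⟩ := hxB
          obtain rfl := eq_of_heq hik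
          exact Or.inr (hpair i h)
        · obtain rfl : n = m := by
            obtain h | ⟨k, h⟩ := hxB
            · cases h
            · cases h; rfl
          exact absurd h hS
        · exact absurd h huniv
      · exact Or.inl (indicator_of_notMem hx _)

end FirstGen

/-- in the first generation space `X̃₁` (branch `n` here is the
paper's branch `n+1`, with `τ n = n+1` leaves of weights `2^{i+1} d n`, masses of
branches halving and `d 0 = 1`), the non-centered maximal operator is of weak type
`(1,1)` with constant `2`: `λ μ({Mf > λ}) ≤ 2 ‖f‖₁` for all `f` and `λ > 0`. -/
theorem Xtilde1_noncen_weak (τ : ℕ → ℕ) (hτ : ∀ n : ℕ, τ n = n + 1)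
    (d : ℕ → ℝ≥0∞) (hd : ∀ n, 0 < d n ∧ d n ≠ ∞) (hd1 : d 0 = 1)
    (F : (n : ℕ) → Fin (τ n) → ℝ≥0∞) (hF : ∀ n i, F n i = 2 ^ ((i : ℕ) + 1))
    (hhalf : ∀ n, mass (weight τ d F) (branch τ (n + 1))
      = mass (weight τ d F) (branch τ n) / 2) :
    ∀ (f : XPt τ → ℝ≥0∞) (l : ℝ≥0∞), 0 < l →
      l * mass (weight τ d F) {x | l < Mnc (weight τ d F) f x}
        ≤ 2 * lpp (weight τ d F) 1 f := by
  intro f l _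
  simp only [lpp, ENNReal.rpow_one]
  by_cases huniv : l * mass (weight τ d F) univ ≤
      ∑' x : (univ : Set (XPt τ)), f x.1 * weight τ d F x.1
  · rw [tsum_univ (fun x => f x * weight τ d F x)] at huniv
    calc _ ≤ l * mass (weight τ d F) univ := by
          gcongr
          exact ENNReal.tsum_mono_subtype _ (subset_univ _)
      _ ≤ _ := huniv.trans (le_mul_of_one_le_left' one_le_two)
  · rw [mass, tsum_subtype, tsum_eq_tsum_branches, tsum_eq_tsum_branches, ← ENNReal.tsum_mul_left,
      ← ENNReal.tsum_mul_left]
    exact ENNReal.tsum_le_tsum (mul_branch_le hF huniv)
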